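/- arXiv:math-ph/0505066 — 5 statements merged into one kernel-verified Lean document; each statement's English description precedes it below -/
import Mathlib

section
/- If a ℂ-linear functional α : A → ℂ satisfies α 1 = 0, then for every k ≥ 0 the k-fold convolution power α^{⋆k} vanishes on every polynomial of total degree strictly less than k; in particular, for any fixed p ∈ A, the convolution-power series of α truncates on p to a finite sum. -/
open MvPolynomial TensorProduct

noncomputable section

/-- The time-ordered field-operator algebra: the free commutative `ℂ`-algebra on
generators `X i`, `i : ι`. -/
abbrev FieldAlg (ι : Type) : Type := MvPolynomial ι ℂ

/-- The coproduct `Δ : A →ₐ[ℂ] A ⊗[ℂ] A`, the unique `ℂ`-algebra homomorphism with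
`Δ (X i) = X i ⊗ 1 + 1 ⊗ X i`. -/
def Cop (ι : Type) : FieldAlg ι →ₐ[ℂ] FieldAlg ι ⊗[ℂ] FieldAlg ι :=
  aeval fun i => X i ⊗ₜ[ℂ] 1 + 1 ⊗ₜ[ℂ] X i

/-- The counit `ε : A →ₐ[ℂ] ℂ`, the constant-coefficient map: the `ℂ`-algebra map
with `ε (X i) = 0` for all `i`. -/
def Cou (ι : Type) : FieldAlg ι →ₐ[ℂ] ℂ :=
  aeval fun _ => 0

/-- The convolution product `α ⋆ β` of two `ℂ`-linear functionals on `A`: the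
composite of the coproduct `Δ` with the linear map `A ⊗ A → ℂ` induced by the
bilinear map `(a, b) ↦ α a * β b`. -/
def conv {ι : Type} [Fintype ι] (α β : FieldAlg ι →ₗ[ℂ] ℂ) : FieldAlg ι →ₗ[ℂ] ℂ :=
  LinearMap.mul' ℂ ℂ ∘ₗ TensorProduct.map α β ∘ₗ (Cop ι).toLinearMap

/-- The `k`-fold convolution power `α^{⋆k}`, with `α^{⋆0} := ε`. -/
def convPow {ι : Type} [Fintype ι] (α : FieldAlg ι →ₗ[ℂ] ℂ) : ℕ → (FieldAlg ι →ₗ[ℂ] ℂ)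
  | 0 => (Cou ι).toLinearMap
  | k + 1 => conv α (convPow α k)


/-- Span of the pure tensors whose right factor has total degree below `d`. -/
def lowSpan (ι : Type) (d : ℕ) : Submodule ℂ (FieldAlg ι ⊗[ℂ] FieldAlg ι) :=
  Submodule.span ℂ {t | ∃ a b : FieldAlg ι, b.totalDegree < d ∧ t = a ⊗ₜ[ℂ] b}

lemma lowSpan_mono {ι : Type} {d e : ℕ} (h : d ≤ e) : lowSpan ι d ≤ lowSpan ι e := by
  apply Submodule.span_mono
  rintro t ⟨a, b, hb, rfl⟩
  exact ⟨a, b, by omega, rfl⟩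

lemma lowSpan_mul {ι : Type} {d : ℕ} (i : ι) (t : FieldAlg ι ⊗[ℂ] FieldAlg ι)
    (ht : t ∈ lowSpan ι d) :
    t * (X i ⊗ₜ[ℂ] 1 + 1 ⊗ₜ[ℂ] X i) ∈ lowSpan ι (d + 1) := by
  unfold lowSpan at ht
  induction ht using Submodule.span_induction with
  | mem t h =>
    obtain ⟨a, b, hb, rfl⟩ := h
    rw [mul_add, Algebra.TensorProduct.tmul_mul_tmul, Algebra.TensorProduct.tmul_mul_tmul]
    refine Submodule.add_mem _ (Submodule.subset_span ⟨_, _, ?_, rfl⟩)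
      (Submodule.subset_span ⟨_, _, ?_, rfl⟩)
    · rw [mul_one]; omega
    · have := totalDegree_mul b (X i : FieldAlg ι)
      rw [totalDegree_X] at this
      omega
  | zero => rw [zero_mul]; exact Submodule.zero_mem _
  | add x y _ _ hx hy => rw [add_mul]; exact Submodule.add_mem _ hx hy
  | smul c x _ hx => rw [smul_mul_assoc]; exact Submodule.smul_mem _ _ hx

lemma Cop_monomial {ι : Type} (s : ι →₀ ℕ) (c : ℂ) :
    Cop ι (monomial s c) - 1 ⊗ₜ[ℂ] (monomial s c) ∈
      lowSpan ι (monomial s c : FieldAlg ι).totalDegree := by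
  refine induction_on_monomial (motive := fun p : FieldAlg ι =>
    Cop ι p - 1 ⊗ₜ[ℂ] p ∈ lowSpan ι p.totalDegree) ?_ ?_ s c
  · intro a
    have h : Cop ι (C a) - 1 ⊗ₜ[ℂ] (C a) = 0 := by
      have h1 : (C a : FieldAlg ι) = a • 1 := by rw [smul_eq_C_mul, mul_one]
      rw [h1, map_smul, map_one, tmul_smul, Algebra.TensorProduct.one_def, sub_self]
    rw [h]; exact Submodule.zero_mem _
  · intro p i hp
    by_cases h0 : p = 0
    · subst h0
      simp
    · rw [totalDegree_mul_of_isDomain h0 (X_ne_zero i), totalDegree_X]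
      have hX : Cop ι (X i) = X i ⊗ₜ[ℂ] 1 + 1 ⊗ₜ[ℂ] X i := by simp [Cop]
      have key : Cop ι (p * X i) - 1 ⊗ₜ[ℂ] (p * X i)
          = (Cop ι p - 1 ⊗ₜ[ℂ] p) * (X i ⊗ₜ[ℂ] 1 + 1 ⊗ₜ[ℂ] X i) + X i ⊗ₜ[ℂ] p := by
        rw [map_mul, hX, sub_mul, mul_add (1 ⊗ₜ[ℂ] p), Algebra.TensorProduct.tmul_mul_tmul,
          Algebra.TensorProduct.tmul_mul_tmul]
        simp only [one_mul, mul_one]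
        abel
      rw [key]
      exact Submodule.add_mem _ (lowSpan_mul i _ hp)
        (Submodule.subset_span ⟨_, _, Nat.lt_succ_self _, rfl⟩)

lemma conv_monomial {ι : Type} [Fintype ι] (α β : FieldAlg ι →ₗ[ℂ] ℂ) (hα : α 1 = 0) (k : ℕ)
    (hβ : ∀ p : FieldAlg ι, p.totalDegree < k → β p = 0) (s : ι →₀ ℕ) (c : ℂ)
    (h : (monomial s c : FieldAlg ι).totalDegree < k + 1) : conv α β (monomial s c) = 0 := by
  have hlow : lowSpan ι k ≤ LinearMap.ker (LinearMap.mul' ℂ ℂ ∘ₗ TensorProduct.map α β) := by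
    apply Submodule.span_le.2
    rintro t ⟨a, b, hb, rfl⟩
    simp [hβ b hb]
  have h1 := hlow (lowSpan_mono (Nat.lt_succ_iff.1 h) (Cop_monomial s c))
  rw [LinearMap.mem_ker, map_sub, sub_eq_zero] at h1
  have h2 : (LinearMap.mul' ℂ ℂ ∘ₗ TensorProduct.map α β)
      ((1 : FieldAlg ι) ⊗ₜ[ℂ] (monomial s c)) = 0 := by
    simp [hα]
  exact h1.trans h2

/-- if a `ℂ`-linear functional `α : A → ℂ` satisfies `α 1 = 0`, then for
every `k ≥ 0` the `k`-fold convolution power `α^{⋆k}` vanishes on every polynomial of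
total degree strictly less than `k` (so for any fixed `p`, the convolution-power
series of `α` truncates on `p` to a finite sum). -/
theorem convPow_vanish {ι : Type} [Fintype ι] (α : FieldAlg ι →ₗ[ℂ] ℂ)
    (hα : α 1 = 0) (k : ℕ) (p : FieldAlg ι) (hp : p.totalDegree < k) :
    convPow α k p = 0 := by
  induction k generalizing p with
  | zero => exact absurd hp (Nat.not_lt_zero _)
  | succ k ih =>
    rw [p.as_sum, map_sum]
    refine Finset.sum_eq_zero fun s hs => ?_
    refine conv_monomial α (convPow α k) hα k ih s _ (lt_of_le_of_lt ?_ hp)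
    exact (totalDegree_monomial_le s _).trans (le_totalDegree hs)

end
end

section
/- (Factorization property of Λ.) For every k ≥ 0 and all p, q ∈ A, Λ^k (p * q) = Λ^k p * Δ^k q in A^{⊗(k+1)}; in particular Λ^k p = Λ^k 1 * Δ^k p for all p ∈ A. -/
open MvPolynomial TensorProduct

noncomputable section

/-- The `k`-fold tensor power `A^{⊗k}` of the free commutative algebra
`A = MvPolynomial ι ℂ`, realized concretely as the free commutative algebra on
`ι × Fin k`: the elementary tensor with `X x` in factor `j` (and `1` elsewhere)
corresponds to the generator `X (x, j)`. -/
abbrev TensPow (ι : Type) (k : ℕ) : Type := MvPolynomial (ι × Fin k) ℂ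

/-- The element `R := ∑_{x,y} c x y • (X x ⊗ X y) ∈ A ⊗ A` built from the
inverse-propagator kernel `c`. -/
def Rtens {ι : Type} [Fintype ι] (c : ι → ι → ℂ) : FieldAlg ι ⊗[ℂ] FieldAlg ι :=
  ∑ x : ι, ∑ y : ι, c x y • (X x ⊗ₜ[ℂ] X y)

/-- The map `Q : A → A ⊗ A`, `Q p := (1/2) • (R * Δ p)`. -/
def Qtens {ι : Type} [Fintype ι] (c : ι → ι → ℂ) :
    FieldAlg ι →ₗ[ℂ] FieldAlg ι ⊗[ℂ] FieldAlg ι :=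
  (1 / 2 : ℂ) • (LinearMap.mulLeft ℂ (Rtens c) ∘ₗ (Cop ι).toLinearMap)

/-- The coproduct applied to the `i`-th tensor factor,
`Δ_i : A^{⊗k} → A^{⊗(k+1)}`: the algebra map splitting the `i`-th factor into the
two adjacent factors `i`, `i+1` (so `X (x, i) ↦ X (x, i) + X (x, i+1)`, which is the
image of `X x ⊗ 1 + 1 ⊗ X x`, the other factors being relabeled accordingly). -/
def copAt (ι : Type) (k : ℕ) (i : Fin k) : TensPow ι k →ₐ[ℂ] TensPow ι (k + 1) :=
  aeval fun p =>
    if p.2.val < i.val then X (p.1, p.2.castSucc)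
    else if p.2.val = i.val then X (p.1, p.2.castSucc) + X (p.1, p.2.succ)
    else X (p.1, p.2.succ)

/-- The iterated coproduct `Δ^k : A → A^{⊗(k+1)}`, defined by `Δ^0 := id` (the
canonical identification `A ≅ A^{⊗1}`) and `Δ^k := (Δ ⊗ id^{⊗(k-1)}) ∘ Δ^{k-1}`
(apply the coproduct to the first tensor factor). -/
def copPow (ι : Type) : (k : ℕ) → (FieldAlg ι →ₐ[ℂ] TensPow ι (k + 1))
  | 0 => rename fun x => (x, (0 : Fin 1))
  | k + 1 => (copAt ι (k + 1) 0).comp (copPow ι k)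

/-- The element `R_{a,b} ∈ A^{⊗k}` (for factors `a, b`): the sum
`∑_{x,y} c x y • (X x in factor a) * (X y in factor b)`. -/
def RPair {ι : Type} [Fintype ι] (c : ι → ι → ℂ) (k : ℕ) (a b : Fin k) : TensPow ι k :=
  ∑ x : ι, ∑ y : ι, c x y • (X (x, a) * X (y, b))

/-- The map `Q_i : A^{⊗k} → A^{⊗(k+1)}`, `a ↦ (1/2) • (R_{i,i+1} * Δ_i a)`. -/
def Qat {ι : Type} [Fintype ι] (c : ι → ι → ℂ) (k : ℕ) (i : Fin k) :
    TensPow ι k →ₗ[ℂ] TensPow ι (k + 1) :=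
  (1 / 2 : ℂ) • (LinearMap.mulLeft ℂ (RPair c (k + 1) i.castSucc i.succ) ∘ₗ
    (copAt ι k i).toLinearMap)

/-- The maps `Λ^k : A → A^{⊗(k+1)}`, defined recursively by `Λ^0 := id` (the
canonical identification `A ≅ A^{⊗1}`) and `Λ^k := (1/k) • ∑_{i=1}^{k} Q_i ∘ Λ^{k-1}`. -/
def Lam {ι : Type} [Fintype ι] (c : ι → ι → ℂ) :
    (k : ℕ) → (FieldAlg ι →ₗ[ℂ] TensPow ι (k + 1))
  | 0 => (rename fun x => (x, (0 : Fin 1)) : FieldAlg ι →ₐ[ℂ] TensPow ι 1).toLinearMap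
  | k + 1 => ((k + 1 : ℕ) : ℂ)⁻¹ • ∑ i : Fin (k + 1), Qat c (k + 1) i ∘ₗ Lam c k


theorem copAt_sum_X (ι : Type) (k : ℕ) (i : Fin k) (x : ι) :
    copAt ι k i (∑ j : Fin k, X (x, j)) = ∑ j : Fin (k + 1), X (x, j) := by
  have key : ∀ j : Fin k, copAt ι k i (X (x, j)) =
      (if j = i then X (x, i.succ) else 0) + X (x, i.succ.succAbove j) := by
    intro j
    simp only [copAt, aeval_X]
    rcases lt_trichotomy j i with h | h | h
    · have h1 : j.val < i.val := h
      rw [if_pos h1, if_neg h.ne, zero_add, Fin.succAbove_of_castSucc_lt]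
      rw [Fin.lt_def]; simp; omega
    · subst h
      rw [if_neg (lt_irrefl _), if_pos rfl, if_pos rfl, Fin.succAbove_of_castSucc_lt]
      · exact add_comm _ _
      rw [Fin.lt_def]; simp
    · have h1 : i.val < j.val := h
      rw [if_neg (by omega), if_neg (by omega), if_neg h.ne', zero_add,
        Fin.succAbove_of_le_castSucc]
      rw [Fin.le_def]; simp; omega
  rw [map_sum, Finset.sum_congr rfl (fun j _ => key j), Finset.sum_add_distrib,
    Fin.sum_univ_succAbove _ i.succ]
  simp

theorem copPow_X (ι : Type) (k : ℕ) (x : ι) :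
    copPow ι k (X x) = ∑ j : Fin (k + 1), X (x, j) := by
  induction k with
  | zero => simp [copPow]
  | succ k ih => rw [copPow, AlgHom.comp_apply, ih, copAt_sum_X]

theorem copAt_copPow (ι : Type) (k : ℕ) (i : Fin (k + 1)) (q : FieldAlg ι) :
    copAt ι (k + 1) i (copPow ι k q) = copPow ι (k + 1) q := by
  have h : (copAt ι (k + 1) i).comp (copPow ι k) = copPow ι (k + 1) := by
    apply MvPolynomial.algHom_ext
    intro x
    rw [AlgHom.comp_apply, copPow_X, copAt_sum_X, copPow_X]
  exact DFunLike.congr_fun h q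

theorem Lam_mul {ι : Type} [Fintype ι] (c : ι → ι → ℂ) (k : ℕ) (p q : FieldAlg ι) :
    Lam c k (p * q) = Lam c k p * copPow ι k q := by
  induction k with
  | zero => simp [Lam, copPow]
  | succ k ih =>
    simp only [Lam, LinearMap.smul_apply, LinearMap.sum_apply, LinearMap.comp_apply, ih, Qat,
      LinearMap.mulLeft_apply, AlgHom.toLinearMap_apply, map_mul, copAt_copPow,
      smul_mul_assoc, Finset.sum_mul, mul_assoc]

/-- factorization property of `Λ`: for every `k ≥ 0` and all
`p q ∈ A`, `Λ^k (p * q) = Λ^k p * Δ^k q` in `A^{⊗(k+1)}`; in particular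
`Λ^k p = Λ^k 1 * Δ^k p`. -/
theorem Lam_factorization {ι : Type} [Fintype ι] (c : ι → ι → ℂ)
    (hc : ∀ x y, c x y = c y x) :
    (∀ (k : ℕ) (p q : FieldAlg ι), Lam c k (p * q) = Lam c k p * copPow ι k q) ∧
    (∀ (k : ℕ) (p : FieldAlg ι), Lam c k p = Lam c k 1 * copPow ι k p) := by
  refine ⟨Lam_mul c, fun k p => ?_⟩
  rw [← Lam_mul, one_mul]

end
end

section
/- (Pair recursion for Λ.) For every k ≥ 2, Λ^{k-1} = (1/(k-1)) • ∑_{i=1}^{k-1} (Λ^{i-1} ⊗ Λ^{k-i-1}) ∘ Q as linear maps A → A^{⊗k}, where (Λ^{i-1} ⊗ Λ^{k-i-1}) ∘ Q means: apply Q : A → A ⊗ A, then apply Λ^{i-1} to the first tensor factor and Λ^{k-i-1} to the second, landing in A^{⊗i} ⊗ A^{⊗(k-i)} ≅ A^{⊗k}. -/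
open MvPolynomial TensorProduct

noncomputable section

/-- The map `A ⊗ A → A^{⊗(m+n)}` induced by `F : A → A^{⊗m}` on the first factor
and `G : A → A^{⊗n}` on the second, using the canonical identification
`A^{⊗m} ⊗ A^{⊗n} ≅ A^{⊗(m+n)}` (first block of `m` factors, second block of `n`). -/
def pairMap {ι : Type} [Fintype ι] (m n : ℕ)
    (F : FieldAlg ι →ₗ[ℂ] TensPow ι m) (G : FieldAlg ι →ₗ[ℂ] TensPow ι n) :
    FieldAlg ι ⊗[ℂ] FieldAlg ι →ₗ[ℂ] TensPow ι (m + n) :=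
  LinearMap.mul' ℂ (TensPow ι (m + n)) ∘ₗ
    TensorProduct.map
      ((rename (Prod.map (id : ι → ι) (Fin.castAdd n))).toLinearMap ∘ₗ F)
      ((rename (Prod.map (id : ι → ι) (Fin.natAdd m))).toLinearMap ∘ₗ G)

/-- All tensor powers at once: factors indexed by `ℕ`. -/
abbrev TN (ι : Type) : Type := MvPolynomial (ι × ℕ) ℂ

def embN (ι : Type) (k : ℕ) : TensPow ι k →ₐ[ℂ] TN ι :=
  rename (Prod.map (id : ι → ι) (Fin.val : Fin k → ℕ))

theorem embN_injective (ι : Type) (k : ℕ) : Function.Injective (embN ι k) :=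
  rename_injective _ (Function.injective_id.prodMap Fin.val_injective)

def shN (ι : Type) (k : ℕ) : TN ι →ₐ[ℂ] TN ι :=
  rename (Prod.map (id : ι → ι) (fun j : ℕ => k + j))

def copN (ι : Type) (i : ℕ) : TN ι →ₐ[ℂ] TN ι :=
  aeval fun p =>
    if p.2 < i then X (p.1, p.2)
    else if p.2 = i then X (p.1, p.2) + X (p.1, p.2 + 1)
    else X (p.1, p.2 + 1)

def RN {ι : Type} [Fintype ι] (c : ι → ι → ℂ) (i : ℕ) : TN ι :=
  ∑ x : ι, ∑ y : ι, c x y • (X (x, i) * X (y, i + 1))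

def QN {ι : Type} [Fintype ι] (c : ι → ι → ℂ) (i : ℕ) : TN ι →ₗ[ℂ] TN ι :=
  (1 / 2 : ℂ) • (LinearMap.mulLeft ℂ (RN c i) ∘ₗ (copN ι i).toLinearMap)

theorem QN_apply {ι : Type} [Fintype ι] (c : ι → ι → ℂ) (i : ℕ) (a : TN ι) :
    QN c i a = (1 / 2 : ℂ) • (RN c i * copN ι i a) := rfl

theorem copN_embN (ι : Type) (k : ℕ) (i : Fin k) (a : TensPow ι k) :
    embN ι (k + 1) (copAt ι k i a) = copN ι i (embN ι k a) := by
  have : (embN ι (k + 1)).comp (copAt ι k i) = (copN ι i).comp (embN ι k) := by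
    ext p : 1
    obtain ⟨x, j⟩ := p
    simp only [embN, copAt, copN, AlgHom.comp_apply, aeval_X, rename_X, Prod.map_apply, id]
    split_ifs <;> simp
  exact DFunLike.congr_fun this a

theorem QN_embN {ι : Type} [Fintype ι] (c : ι → ι → ℂ) (k : ℕ) (i : Fin k) (a : TensPow ι k) :
    embN ι (k + 1) (Qat c k i a) = QN c i (embN ι k a) := by
  have h : embN ι (k + 1) (RPair c (k + 1) i.castSucc i.succ) = RN c i := by
    simp [embN, RPair, RN, map_sum]
  rw [QN_apply, ← h, ← copN_embN, ← map_mul, ← map_smul]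
  rfl

theorem copN_shN (ι : Type) (k i : ℕ) (h : i < k) (a : TN ι) :
    copN ι i (shN ι k a) = shN ι (k + 1) a := by
  have : (copN ι i).comp (shN ι k) = shN ι (k + 1) := by
    ext p : 1
    obtain ⟨x, j⟩ := p
    simp only [shN, copN, AlgHom.comp_apply, aeval_X, rename_X, Prod.map_apply, id]
    rw [if_neg (by omega), if_neg (by omega)]
    congr 2; omega
  exact DFunLike.congr_fun this a

theorem copN_shN' (ι : Type) (k i : ℕ) (a : TN ι) :
    copN ι (k + i) (shN ι k a) = shN ι k (copN ι i a) := by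
  have : (copN ι (k + i)).comp (shN ι k) = (shN ι k).comp (copN ι i) := by
    ext p : 1
    obtain ⟨x, j⟩ := p
    simp only [shN, copN, AlgHom.comp_apply, aeval_X, rename_X, Prod.map_apply, id,
      add_lt_add_iff_left, add_right_inj]
    split_ifs <;> simp [add_assoc]
  exact DFunLike.congr_fun this a

theorem copN_embN_ge (ι : Type) (k i : ℕ) (h : k ≤ i) (a : TensPow ι k) :
    copN ι i (embN ι k a) = embN ι k a := by
  have : (copN ι i).comp (embN ι k) = embN ι k := by
    ext p : 1
    obtain ⟨x, j⟩ := p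
    simp only [embN, copN, AlgHom.comp_apply, aeval_X, rename_X, Prod.map_apply, id]
    rw [if_pos (by omega)]
  exact DFunLike.congr_fun this a

theorem shN_RN {ι : Type} [Fintype ι] (c : ι → ι → ℂ) (k i : ℕ) :
    shN ι k (RN c i) = RN c (k + i) := by
  simp [shN, RN, map_sum, add_assoc]

theorem QN_left {ι : Type} [Fintype ι] (c : ι → ι → ℂ) (k i : ℕ) (h : i < k) (a b : TN ι) :
    QN c i (a * shN ι k b) = QN c i a * shN ι (k + 1) b := by
  rw [QN_apply, QN_apply, map_mul, copN_shN ι k i h, smul_mul_assoc, mul_assoc]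

theorem QN_right {ι : Type} [Fintype ι] (c : ι → ι → ℂ) (k i : ℕ) (a : TensPow ι k) (b : TN ι) :
    QN c (k + i) (embN ι k a * shN ι k b) = embN ι k a * shN ι k (QN c i b) := by
  rw [QN_apply, QN_apply, map_mul, copN_shN', copN_embN_ge ι k _ (by omega), map_smul, map_mul,
    shN_RN, mul_smul_comm, mul_left_comm]

def LN {ι : Type} [Fintype ι] (c : ι → ι → ℂ) (k : ℕ) : FieldAlg ι →ₗ[ℂ] TN ι :=
  (embN ι (k + 1)).toLinearMap ∘ₗ Lam c k

theorem LN_apply {ι : Type} [Fintype ι] (c : ι → ι → ℂ) (k : ℕ) (a : FieldAlg ι) :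
    LN c k a = embN ι (k + 1) (Lam c k a) := rfl

theorem LN_succ {ι : Type} [Fintype ι] (c : ι → ι → ℂ) (k : ℕ) (a : FieldAlg ι) :
    ∑ i ∈ Finset.range (k + 1), QN c i (LN c k a) = ((k : ℂ) + 1) • LN c (k + 1) a := by
  have hk : (k : ℂ) + 1 ≠ 0 := by exact_mod_cast Nat.succ_ne_zero k
  rw [LN_apply, LN_apply, Lam]
  simp only [LinearMap.smul_apply, LinearMap.sum_apply, LinearMap.comp_apply, map_smul, map_sum,
    QN_embN]
  rw [Nat.cast_succ, smul_inv_smul₀ hk, ← Fin.sum_univ_eq_sum_range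
    (fun i => QN c i (embN ι (k + 1) (Lam c k a)))]

def PN {ι : Type} [Fintype ι] (c : ι → ι → ℂ) (p q : ℕ) :
    FieldAlg ι ⊗[ℂ] FieldAlg ι →ₗ[ℂ] TN ι :=
  LinearMap.mul' ℂ (TN ι) ∘ₗ
    TensorProduct.map (LN c p) ((shN ι (p + 1)).toLinearMap ∘ₗ LN c q)

theorem PN_tmul {ι : Type} [Fintype ι] (c : ι → ι → ℂ) (p q : ℕ) (a b : FieldAlg ι) :
    PN c p q (a ⊗ₜ b) = LN c p a * shN ι (p + 1) (LN c q b) := rfl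

theorem PN_key {ι : Type} [Fintype ι] (c : ι → ι → ℂ) (p q : ℕ) (t : FieldAlg ι ⊗[ℂ] FieldAlg ι) :
    ∑ i ∈ Finset.range (p + q + 2), QN c i (PN c p q t) =
      ((p : ℂ) + 1) • PN c (p + 1) q t + ((q : ℂ) + 1) • PN c p (q + 1) t := by
  induction t using TensorProduct.induction_on with
  | zero => simp
  | add x y hx hy =>
    simp only [map_add, Finset.sum_add_distrib, smul_add, hx, hy]
    abel
  | tmul a b =>
    simp only [PN_tmul]
    rw [show p + q + 2 = (p + 1) + (q + 1) by ring, Finset.sum_range_add]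
    congr 1
    · rw [← smul_mul_assoc, ← LN_succ, Finset.sum_mul]
      refine Finset.sum_congr rfl fun i hi => ?_
      rw [QN_left c _ _ (Finset.mem_range.1 hi)]
    · rw [← mul_smul_comm, ← map_smul, ← LN_succ, map_sum, Finset.mul_sum]
      refine Finset.sum_congr rfl fun i _ => ?_
      rw [LN_apply c p, QN_right]

theorem LN_zero {ι : Type} [Fintype ι] (c : ι → ι → ℂ) (a : FieldAlg ι) :
    LN c 0 a = rename (fun x => (x, (0 : ℕ))) a := by
  rw [LN_apply, Lam, embN]
  simp only [AlgHom.toLinearMap_apply, rename_rename]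
  rfl

theorem PN_zero {ι : Type} [Fintype ι] (c : ι → ι → ℂ) (t : FieldAlg ι ⊗[ℂ] FieldAlg ι) :
    PN c 0 0 t = Algebra.TensorProduct.productMap
      (rename (fun x => (x, (0 : ℕ))) : FieldAlg ι →ₐ[ℂ] TN ι)
      (rename (fun x => (x, (1 : ℕ))) : FieldAlg ι →ₐ[ℂ] TN ι) t := by
  induction t using TensorProduct.induction_on with
  | zero => simp
  | add x y hx hy => rw [map_add, map_add, hx, hy]
  | tmul a b =>
    rw [PN_tmul, LN_zero, LN_zero, Algebra.TensorProduct.productMap_apply_tmul, shN, rename_rename]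
    rfl

theorem PN_base {ι : Type} [Fintype ι] (c : ι → ι → ℂ) (a : FieldAlg ι) :
    LN c 1 a = PN c 0 0 (Qtens c a) := by
  have h := LN_succ c 0 a
  simp only [zero_add, Finset.sum_range_one, Nat.cast_zero, one_smul] at h
  rw [← h, PN_zero, LN_zero, QN_apply, Qtens]
  simp only [LinearMap.smul_apply, LinearMap.comp_apply, LinearMap.mulLeft_apply, map_smul,
    map_mul, AlgHom.toLinearMap_apply]
  congr 2
  · simp [RN, Rtens, map_sum]
  · rw [← AlgHom.comp_apply, ← AlgHom.comp_apply]
    congr 1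
    ext x : 1
    simp [copN, Cop]

theorem LN_pair {ι : Type} [Fintype ι] (c : ι → ι → ℂ) (m : ℕ) (a : FieldAlg ι) :
    ((m : ℂ) + 1) • LN c (m + 1) a =
      ∑ pq ∈ Finset.HasAntidiagonal.antidiagonal m, PN c pq.1 pq.2 (Qtens c a) := by
  induction m with
  | zero => simp [PN_base]
  | succ m ih =>
    have hm : (m : ℂ) + 1 ≠ 0 := by exact_mod_cast Nat.succ_ne_zero m
    apply smul_right_injective _ hm
    simp only
    rw [← LN_succ c (m + 1), Finset.smul_sum]
    simp only [← map_smul, ih]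
    simp only [map_sum]
    rw [Finset.sum_comm]
    have h1 : ∀ pq ∈ Finset.HasAntidiagonal.antidiagonal m,
        ∑ i ∈ Finset.range (m + 1 + 1), QN c i (PN c pq.1 pq.2 (Qtens c a)) =
        ((pq.1 : ℂ) + 1) • PN c (pq.1 + 1) pq.2 (Qtens c a) +
          ((pq.2 : ℂ) + 1) • PN c pq.1 (pq.2 + 1) (Qtens c a) := by
      intro pq h
      rw [← PN_key, Finset.HasAntidiagonal.mem_antidiagonal.1 h]
    rw [Finset.sum_congr rfl h1, Finset.sum_add_distrib]
    have h2 := Finset.Nat.sum_antidiagonal_succ (n := m)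
      (f := fun pq => (pq.1 : ℂ) • PN c pq.1 pq.2 (Qtens c a))
    have h3 := Finset.Nat.sum_antidiagonal_succ' (n := m)
      (f := fun pq => (pq.2 : ℂ) • PN c pq.1 pq.2 (Qtens c a))
    simp only [Nat.cast_zero, zero_smul, zero_add, Nat.cast_succ, add_zero] at h2 h3
    rw [← h2, ← h3, ← Finset.sum_add_distrib, Finset.smul_sum]
    refine Finset.sum_congr rfl fun pq h => ?_
    rw [← add_smul]
    congr 1
    exact_mod_cast Finset.HasAntidiagonal.mem_antidiagonal.1 h

theorem emb_pair {ι : Type} [Fintype ι] (c : ι → ι → ℂ) (p q k : ℕ)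
    (hk : (p + 1) + (q + 1) = k) (t : FieldAlg ι ⊗[ℂ] FieldAlg ι) :
    embN ι k (rename (Prod.map (id : ι → ι) (Fin.cast hk))
      (pairMap (p + 1) (q + 1) (Lam c p) (Lam c q) t)) = PN c p q t := by
  induction t using TensorProduct.induction_on with
  | zero => simp
  | add x y hx hy => simp only [map_add, hx, hy]
  | tmul a b =>
    rw [PN_tmul]
    simp only [pairMap, LinearMap.comp_apply, TensorProduct.map_tmul, LinearMap.mul'_apply,
      map_mul, AlgHom.toLinearMap_apply, LN_apply, embN, shN, rename_rename]
    rfl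

/-- pair recursion for `Λ`: for every `k ≥ 2` — written here as
`k = m + 1` with `m ≥ 1` — one has
`Λ^{k-1} = (1/(k-1)) • ∑_{i=1}^{k-1} (Λ^{i-1} ⊗ Λ^{k-i-1}) ∘ Q`,
where the `i`-th summand applies `Q : A → A ⊗ A`, then `Λ^{i-1}` to the first and
`Λ^{k-i-1}` to the second tensor factor, landing in
`A^{⊗i} ⊗ A^{⊗(k-i)} ≅ A^{⊗k}`. -/
theorem Lam_pair_recursion {ι : Type} [Fintype ι] (c : ι → ι → ℂ)
    (hc : ∀ x y, c x y = c y x) (m : ℕ) (hm : 1 ≤ m) :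
    Lam c m = ((m : ℕ) : ℂ)⁻¹ •
      ∑ i : Fin m,
        (rename (Prod.map (id : ι → ι)
            (Fin.cast (by have := i.isLt; omega :
              (i.val + 1) + ((m - i.val - 1) + 1) = m + 1)))).toLinearMap ∘ₗ
          pairMap (i.val + 1) ((m - i.val - 1) + 1)
            (Lam c i.val) (Lam c (m - i.val - 1)) ∘ₗ Qtens c := by
  obtain ⟨m, rfl⟩ : ∃ n, m = n + 1 := ⟨m - 1, by omega⟩
  have hm' : (m : ℂ) + 1 ≠ 0 := by exact_mod_cast Nat.succ_ne_zero m
  refine LinearMap.ext fun a => embN_injective ι _ ?_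
  rw [← LN_apply, LinearMap.smul_apply, map_smul, Nat.cast_succ, eq_inv_smul_iff₀ hm', LN_pair,
    LinearMap.sum_apply, map_sum, Finset.Nat.sum_antidiagonal_eq_sum_range_succ_mk,
    ← Fin.sum_univ_eq_sum_range (fun i => PN c i (m - i) (Qtens c a))]
  refine Finset.sum_congr rfl fun i _ => ?_
  simp only [LinearMap.comp_apply, AlgHom.toLinearMap_apply]
  rw [emb_pair, show m + 1 - i.val - 1 = m - i.val by omega]

end
end

section
/- (Recursion for the vertex-number components of the connected functions.) Let τ : A → ℂ be any ℂ-linear functional and for k ≥ 1 define σ^k := τ^{⊗k} ∘ Λ^{k-1} : A → ℂ, where τ^{⊗k} : A^{⊗k} → ℂ is the linear functional induced by τ on the k-fold tensor power. Then σ^1 = τ, and for every k ≥ 2, σ^k = (1/(k-1)) • ∑_{i=1}^{k-1} (σ^i ⊗ σ^{k-i}) ∘ Q, where (σ^i ⊗ σ^{k-i}) ∘ Q means: apply Q : A → A ⊗ A and then the linear functional induced by applying σ^i to the first and σ^{k-i} to the second tensor factor. -/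
open MvPolynomial TensorProduct

noncomputable section

/-- The functional `(α ⊗ β) ∘ Q : A → ℂ`: apply `Q : A → A ⊗ A` and then the linear
functional induced by applying `α` to the first and `β` to the second tensor factor. -/
def pairFunQ {ι : Type} [Fintype ι] (c : ι → ι → ℂ) (α β : FieldAlg ι →ₗ[ℂ] ℂ) :
    FieldAlg ι →ₗ[ℂ] ℂ :=
  LinearMap.mul' ℂ ℂ ∘ₗ TensorProduct.map α β ∘ₗ Qtens c

/-- Juxtaposition of tensor powers. -/
def Jx (ι : Type) (a b n : ℕ) : TensPow ι a ⊗[ℂ] TensPow ι b →ₐ[ℂ] TensPow ι (n + 1) :=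
  Algebra.TensorProduct.productMap
    (rename fun p : ι × Fin a => (p.1, Fin.ofNat (n + 1) p.2.val))
    (rename fun p : ι × Fin b => (p.1, Fin.ofNat (n + 1) (a + p.2.val)))

lemma ofNat_left (a b : ℕ) (j : Fin a) : Fin.ofNat (a + b + 1) j.val = Fin.castAdd (b + 1) j := by
  apply Fin.ext
  simp only [Fin.ofNat, Fin.val_castAdd]
  exact Nat.mod_eq_of_lt (by omega)

lemma ofNat_right (a b : ℕ) (j : Fin (b + 1)) :
    Fin.ofNat (a + b + 1) (a + j.val) = Fin.natAdd a j := by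
  apply Fin.ext
  simp only [Fin.ofNat, Fin.val_natAdd]
  exact Nat.mod_eq_of_lt (by omega)

lemma prod_split {M : Type} [CommMonoid M] (a b : ℕ) (f : Fin (a + b + 1) → M) :
    ∏ j, f j = (∏ j : Fin a, f (Fin.castAdd (b + 1) j)) * ∏ j : Fin (b + 1), f (Fin.natAdd a j) :=
  Fin.prod_univ_add (a := a) (b := b + 1) f

lemma sum_split {M : Type} [AddCommMonoid M] (a b : ℕ) (f : Fin (a + b + 1) → M) :
    ∑ j, f j = (∑ j : Fin a, f (Fin.castAdd (b + 1) j)) + ∑ j : Fin (b + 1), f (Fin.natAdd a j) :=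
  Fin.sum_univ_add (a := a) (b := b + 1) f

lemma TensPow_ext {ι : Type} [Fintype ι] {k : ℕ} {M : Type} [AddCommMonoid M] [Module ℂ M]
    (f g : TensPow ι k →ₗ[ℂ] M)
    (h : ∀ p : Fin k → FieldAlg ι, f (∏ j : Fin k, rename (fun x => (x, j)) (p j)) =
      g (∏ j : Fin k, rename (fun x => (x, j)) (p j))) : f = g := by
  apply LinearMap.ext
  intro q
  induction q using MvPolynomial.induction_on' with
  | monomial s z =>
    have e : (monomial s z : TensPow ι k) = z • ∏ j : Fin k, rename (fun x => (x, j))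
        (∏ x : ι, (X x : FieldAlg ι) ^ s (x, j)) := by
      rw [monomial_eq, Finsupp.prod_fintype _ _ (by simp), Fintype.prod_prod_type_right,
        ← smul_eq_C_mul]
      simp [map_prod]
    rw [e, map_smul, map_smul, h]
  | add p q hp hq => rw [map_add, map_add, hp, hq]

lemma T_Jx {ι : Type} [Fintype ι] (τ : FieldAlg ι →ₗ[ℂ] ℂ)
    (T : ∀ k : ℕ, TensPow ι k →ₗ[ℂ] ℂ)
    (hT : ∀ (k : ℕ) (p : Fin k → FieldAlg ι),
      T k (∏ j : Fin k, rename (fun x => (x, j)) (p j)) = ∏ j : Fin k, τ (p j))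
    (a b n : ℕ) (h : n = a + b) :
    T (n + 1) ∘ₗ (Jx ι a (b + 1) n).toLinearMap =
      LinearMap.mul' ℂ ℂ ∘ₗ TensorProduct.map (T a) (T (b + 1)) := by
  subst h
  apply TensorProduct.ext
  apply TensPow_ext
  intro p
  apply TensPow_ext
  intro q
  show T (a + b + 1) (Jx ι a (b + 1) (a + b) (_ ⊗ₜ _)) = T a _ * T (b + 1) _
  simp only [hT, Jx,
    Algebra.TensorProduct.productMap_apply_tmul, map_prod, rename_rename]
  have key := hT (a + b + 1) (Fin.append (m := a) (n := b + 1) p q)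
  rw [prod_split, prod_split] at key
  simp only [Fin.append_left, Fin.append_right] at key
  rw [← key]
  congr 2
  · refine Finset.prod_congr rfl fun j _ => ?_
    congr 2
    funext x
    simp only [Function.comp, ofNat_left]
  · refine Finset.prod_congr rfl fun j _ => ?_
    congr 2
    funext x
    simp only [Function.comp, ofNat_right]

lemma Qat_Jx_left {ι : Type} [Fintype ι] (c : ι → ι → ℂ) (a b n : ℕ) (h : n = a + b) (j : Fin a)
    (p : TensPow ι a) (q : TensPow ι (b + 1)) :
    Qat c (n + 1) (Fin.ofNat (n + 1) j.val) (Jx ι a (b + 1) n (p ⊗ₜ q)) =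
      Jx ι (a + 1) (b + 1) (n + 1) (Qat c a j p ⊗ₜ q) := by
  subst h
  have hl : (copAt ι (a + b + 1) (Fin.ofNat (a + b + 1) j.val)).comp
      (rename fun p : ι × Fin a => (p.1, Fin.ofNat (a + b + 1) p.2.val)) =
      (rename fun p : ι × Fin (a + 1) => (p.1, Fin.ofNat (a + b + 1 + 1) p.2.val)).comp
        (copAt ι a j) := by
    apply MvPolynomial.algHom_ext
    rintro ⟨x, i⟩
    simp only [AlgHom.comp_apply, rename_X, copAt, aeval_X, ofNat_left, Fin.val_castAdd]
    have e1 : Fin.ofNat (a + b + 1 + 1) i.val = (Fin.castAdd (b + 1) i).castSucc :=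
      Fin.ext (Nat.mod_eq_of_lt (by omega))
    have e2 : Fin.ofNat (a + b + 1 + 1) (i.val + 1) = (Fin.castAdd (b + 1) i).succ :=
      Fin.ext (Nat.mod_eq_of_lt (by omega))
    split_ifs <;> simp only [map_add, rename_X, Fin.val_castSucc, Fin.val_succ, e1, e2]
  have hr : (copAt ι (a + b + 1) (Fin.ofNat (a + b + 1) j.val)).comp
      (rename fun p : ι × Fin (b + 1) => (p.1, Fin.ofNat (a + b + 1) (a + p.2.val))) =
      (rename fun p : ι × Fin (b + 1) => (p.1, Fin.ofNat (a + b + 1 + 1) (a + 1 + p.2.val))) := by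
    apply MvPolynomial.algHom_ext
    rintro ⟨x, i⟩
    simp only [AlgHom.comp_apply, rename_X, copAt, aeval_X, ofNat_left, ofNat_right,
      Fin.val_castAdd, Fin.val_natAdd]
    rw [if_neg (by omega), if_neg (by omega)]
    congr 2
    exact Fin.ext (by simp only [Fin.ofNat, Fin.val_succ, Fin.val_natAdd]
                      rw [Nat.mod_eq_of_lt (by omega)]; omega)
  have hR : RPair c (a + b + 1 + 1) (Fin.ofNat (a + b + 1) j.val).castSucc
      (Fin.ofNat (a + b + 1) j.val).succ =
      rename (fun p : ι × Fin (a + 1) => (p.1, Fin.ofNat (a + b + 1 + 1) p.2.val))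
        (RPair c (a + 1) j.castSucc j.succ) := by
    have e1 : Fin.ofNat (a + b + 1 + 1) j.val = (Fin.castAdd (b + 1) j).castSucc :=
      Fin.ext (Nat.mod_eq_of_lt (by omega))
    have e2 : Fin.ofNat (a + b + 1 + 1) (j.val + 1) = (Fin.castAdd (b + 1) j).succ :=
      Fin.ext (Nat.mod_eq_of_lt (by omega))
    simp only [RPair, map_sum, map_smul, map_mul, rename_X, Fin.val_castSucc, Fin.val_succ, e1, e2,
      ofNat_left]
  have hl' := DFunLike.congr_fun hl p
  have hr' := DFunLike.congr_fun hr q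
  simp only [AlgHom.comp_apply] at hl' hr'
  simp only [Qat, Jx, LinearMap.smul_apply, LinearMap.comp_apply, LinearMap.mulLeft_apply,
    AlgHom.toLinearMap_apply, Algebra.TensorProduct.productMap_apply_tmul, map_mul, map_smul,
    hl', hr', hR, smul_mul_assoc, mul_assoc]

lemma Qat_Jx_right {ι : Type} [Fintype ι] (c : ι → ι → ℂ) (a b n : ℕ) (h : n = a + b)
    (j : Fin (b + 1)) (p : TensPow ι a) (q : TensPow ι (b + 1)) :
    Qat c (n + 1) (Fin.ofNat (n + 1) (a + j.val)) (Jx ι a (b + 1) n (p ⊗ₜ q)) =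
      Jx ι a (b + 1 + 1) (n + 1) (p ⊗ₜ Qat c (b + 1) j q) := by
  subst h
  have hl : (copAt ι (a + b + 1) (Fin.ofNat (a + b + 1) (a + j.val))).comp
      (rename fun p : ι × Fin a => (p.1, Fin.ofNat (a + b + 1) p.2.val)) =
      (rename fun p : ι × Fin a => (p.1, Fin.ofNat (a + b + 1 + 1) p.2.val)) := by
    apply MvPolynomial.algHom_ext
    rintro ⟨x, i⟩
    simp only [AlgHom.comp_apply, rename_X, copAt, aeval_X, ofNat_left, ofNat_right,
      Fin.val_castAdd, Fin.val_natAdd]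
    rw [if_pos (by omega)]
    congr 2
    exact Fin.ext (by simp only [Fin.ofNat, Fin.val_castSucc, Fin.val_castAdd]
                      rw [Nat.mod_eq_of_lt (by omega)])
  have hr : (copAt ι (a + b + 1) (Fin.ofNat (a + b + 1) (a + j.val))).comp
      (rename fun p : ι × Fin (b + 1) => (p.1, Fin.ofNat (a + b + 1) (a + p.2.val))) =
      (rename fun p : ι × Fin (b + 1 + 1) => (p.1, Fin.ofNat (a + b + 1 + 1) (a + p.2.val))).comp
        (copAt ι (b + 1) j) := by
    apply MvPolynomial.algHom_ext
    rintro ⟨x, i⟩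
    simp only [AlgHom.comp_apply, rename_X, copAt, aeval_X, ofNat_right, Fin.val_natAdd,
      Nat.add_lt_add_iff_left, Nat.add_left_cancel_iff]
    have e1 : Fin.ofNat (a + b + 1 + 1) (a + i.val) = (Fin.natAdd a i).castSucc :=
      Fin.ext (Nat.mod_eq_of_lt (by omega))
    have e2 : Fin.ofNat (a + b + 1 + 1) (a + (i.val + 1)) = (Fin.natAdd a i).succ :=
      Fin.ext (Nat.mod_eq_of_lt (by omega))
    split_ifs <;> simp only [map_add, rename_X, Fin.val_castSucc, Fin.val_succ, e1, e2]
  have hR : RPair c (a + b + 1 + 1) (Fin.ofNat (a + b + 1) (a + j.val)).castSucc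
      (Fin.ofNat (a + b + 1) (a + j.val)).succ =
      rename (fun p : ι × Fin (b + 1 + 1) => (p.1, Fin.ofNat (a + b + 1 + 1) (a + p.2.val)))
        (RPair c (b + 1 + 1) j.castSucc j.succ) := by
    have e1 : Fin.ofNat (a + b + 1 + 1) (a + j.val) = (Fin.natAdd a j).castSucc :=
      Fin.ext (Nat.mod_eq_of_lt (by omega))
    have e2 : Fin.ofNat (a + b + 1 + 1) (a + (j.val + 1)) = (Fin.natAdd a j).succ :=
      Fin.ext (Nat.mod_eq_of_lt (by omega))
    simp only [RPair, map_sum, map_smul, map_mul, rename_X, Fin.val_castSucc, Fin.val_succ, e1, e2,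
      ofNat_right]
  have hl' := DFunLike.congr_fun hl p
  have hr' := DFunLike.congr_fun hr q
  simp only [AlgHom.comp_apply] at hl' hr'
  simp only [Qat, Jx, LinearMap.smul_apply, LinearMap.comp_apply, LinearMap.mulLeft_apply,
    AlgHom.toLinearMap_apply, Algebra.TensorProduct.productMap_apply_tmul, map_mul, map_smul,
    hl', hr', hR, mul_smul_comm]
  congr 1
  ring

/-- `Λ^a ⊗ Λ^b`, landing in the juxtaposed tensor power. -/
def Ex {ι : Type} [Fintype ι] (c : ι → ι → ℂ) (a b n : ℕ) :
    FieldAlg ι ⊗[ℂ] FieldAlg ι →ₗ[ℂ] TensPow ι (n + 1) :=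
  (Jx ι (a + 1) (b + 1) n).toLinearMap ∘ₗ TensorProduct.map (Lam c a) (Lam c b)

lemma Lam_succ {ι : Type} [Fintype ι] (c : ι → ι → ℂ) (k : ℕ) (p : FieldAlg ι) :
    ∑ i : Fin (k + 1), Qat c (k + 1) i (Lam c k p) = ((k : ℂ) + 1) • Lam c (k + 1) p := by
  have h : ((k : ℂ) + 1) ≠ 0 := by exact_mod_cast Nat.succ_ne_zero k
  simp only [Lam, LinearMap.smul_apply, LinearMap.sum_apply, LinearMap.comp_apply, smul_smul]
  push_cast
  rw [mul_inv_cancel₀ h, one_smul]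

lemma Qat_Ex {ι : Type} [Fintype ι] (c : ι → ι → ℂ) (a b n : ℕ) (h : n = a + 1 + b)
    (t : FieldAlg ι ⊗[ℂ] FieldAlg ι) :
    ∑ j : Fin (n + 1), Qat c (n + 1) j (Ex c a b n t) =
      ((a : ℂ) + 1) • Ex c (a + 1) b (n + 1) t + ((b : ℂ) + 1) • Ex c a (b + 1) (n + 1) t := by
  induction t using TensorProduct.induction_on with
  | zero => simp
  | add x y hx hy =>
    simp only [map_add, Finset.sum_add_distrib, hx, hy, smul_add]
    abel
  | tmul p q =>
    simp only [Ex, LinearMap.comp_apply, TensorProduct.map_tmul, AlgHom.toLinearMap_apply]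
    have hs : ∀ f : Fin (n + 1) → TensPow ι (n + 1 + 1), ∑ j, f j =
        ∑ j : Fin (a + 1), f (Fin.ofNat (n + 1) j.val) +
        ∑ j : Fin (b + 1), f (Fin.ofNat (n + 1) (a + 1 + j.val)) := by
      subst h
      intro f
      rw [sum_split]
      simp only [ofNat_left, ofNat_right]
    rw [hs]
    simp only [Qat_Jx_left c _ _ n h, Qat_Jx_right c _ _ n h]
    rw [← map_sum, ← map_sum, ← TensorProduct.sum_tmul, ← TensorProduct.tmul_sum, Lam_succ,
      Lam_succ, TensorProduct.tmul_smul, ← TensorProduct.smul_tmul', map_smul, map_smul]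

lemma Lam_rec {ι : Type} [Fintype ι] (c : ι → ι → ℂ) (m : ℕ) (p : FieldAlg ι) :
    ((m : ℂ) + 1) • Lam c (m + 1) p =
      ∑ i ∈ Finset.range (m + 1), Ex c i (m - i) (m + 1) (Qtens c p) := by
  induction m with
  | zero =>
    have hC : ((Jx ι 1 1 1).toLinearMap ∘ₗ TensorProduct.map (Lam c 0) (Lam c 0)) =
        ((Jx ι 1 1 1).comp (Algebra.TensorProduct.map
          (rename fun x => (x, (0 : Fin 1))) (rename fun x => (x, (0 : Fin 1))))).toLinearMap := by
      apply TensorProduct.ext'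
      intro x y
      rfl
    have hD : ((copAt ι 1 0).comp (rename fun x => (x, (0 : Fin 1)))) =
        ((Jx ι 1 1 1).comp (Algebra.TensorProduct.map
          (rename fun x => (x, (0 : Fin 1))) (rename fun x => (x, (0 : Fin 1))))).comp (Cop ι) := by
      apply MvPolynomial.algHom_ext
      intro x
      simp [copAt, Cop, Jx]
    have hD' := DFunLike.congr_fun hD p
    simp only [AlgHom.comp_apply] at hD'
    have hL : ∑ i : Fin (0 + 1), Qat c (0 + 1) i (Lam c 0 p) = Qat c 1 0 (Lam c 0 p) :=
      Fin.sum_univ_one _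
    rw [← Lam_succ, hL]
    simp only [Finset.sum_range_one, zero_add, Ex, Nat.sub_zero, hC]
    simp only [Lam, Qat, Qtens,
      LinearMap.smul_apply, LinearMap.comp_apply, LinearMap.mulLeft_apply,
      AlgHom.toLinearMap_apply, map_smul, map_mul, AlgHom.comp_apply, hD']
    congr 2
    simp [RPair, Rtens, Jx]
  | succ m ih =>
    have hne : ((m : ℂ) + 1) ≠ 0 := by exact_mod_cast Nat.succ_ne_zero m
    have h1 := Lam_succ c (m + 1) p
    apply smul_right_injective _ hne
    show ((m : ℂ) + 1) • _ = ((m : ℂ) + 1) • _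
    rw [← h1, Finset.smul_sum]
    have h3 : ∀ x, ((m : ℂ) + 1) • Qat c (m + 1 + 1) x (Lam c (m + 1) p) =
        Qat c (m + 1 + 1) x (((m : ℂ) + 1) • Lam c (m + 1) p) := fun x => (map_smul _ _ _).symm
    simp only [h3, ih, map_sum]
    rw [Finset.sum_comm]
    set G : ℕ → TensPow ι (m + 1 + 1 + 1) := fun i =>
      Ex c i (m + 1 - i) (m + 1 + 1) (Qtens c p) with hG
    have hstep : ∀ i ∈ Finset.range (m + 1),
        ∑ j : Fin (m + 1 + 1), Qat c (m + 1 + 1) j (Ex c i (m - i) (m + 1) (Qtens c p)) =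
        (((i + 1 : ℕ) : ℂ)) • G (i + 1) + ((m : ℂ) + 1 - i) • G i := by
      intro i hi
      have hi' : i ≤ m := by simpa [Nat.lt_succ_iff] using hi
      rw [Qat_Ex c i (m - i) (m + 1) (by omega)]
      simp only [hG]
      rw [show m + 1 - (i + 1) = m - i by omega, show m + 1 - i = m - i + 1 by omega,
        Nat.cast_sub hi']
      push_cast
      rw [show (m : ℂ) - i + 1 = m + 1 - i by ring]
    rw [Finset.sum_congr rfl hstep, Finset.sum_add_distrib]
    have s1 := Finset.sum_range_succ' (fun i : ℕ => (i : ℂ) • G i) (m + 1)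
    have s2 := Finset.sum_range_succ (fun i : ℕ => ((m : ℂ) + 1 - i) • G i) (m + 1)
    simp only [Nat.cast_zero, zero_smul, add_zero] at s1
    rw [show ((m : ℂ) + 1 - (m + 1 : ℕ)) = 0 by push_cast; ring, zero_smul, add_zero] at s2
    rw [← s1, ← s2, ← Finset.sum_add_distrib, Finset.smul_sum]
    refine Finset.sum_congr rfl fun i _ => ?_
    rw [← add_smul]
    congr 1
    ring

/-- recursion for the vertex-number components of the connected
functions: let `τ : A → ℂ` be any `ℂ`-linear functional and let `T k : A^{⊗k} → ℂ`
be the induced functional `τ^{⊗k}` on the `k`-fold tensor power, characterized by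
`T k (∏ j, pⱼ placed in factor j) = ∏ j, τ pⱼ`. With `σ^k := τ^{⊗k} ∘ Λ^{k-1}`, one
has `σ^1 = τ` and, for every `k ≥ 2` — written `k = m + 1` with `m ≥ 1` —
`σ^k = (1/(k-1)) • ∑_{i=1}^{k-1} (σ^i ⊗ σ^{k-i}) ∘ Q`. -/
theorem sigma_recursion {ι : Type} [Fintype ι] (c : ι → ι → ℂ)
    (hc : ∀ x y, c x y = c y x) (τ : FieldAlg ι →ₗ[ℂ] ℂ)
    (T : ∀ k : ℕ, TensPow ι k →ₗ[ℂ] ℂ)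
    (hT : ∀ (k : ℕ) (p : Fin k → FieldAlg ι),
      T k (∏ j : Fin k, rename (fun x => (x, j)) (p j)) = ∏ j : Fin k, τ (p j)) :
    (T 1 ∘ₗ Lam c 0 = τ) ∧
    (∀ m : ℕ, 1 ≤ m →
      T (m + 1) ∘ₗ Lam c m = ((m : ℕ) : ℂ)⁻¹ •
        ∑ i : Fin m,
          pairFunQ c (T (i.val + 1) ∘ₗ Lam c i.val)
            (T ((m - i.val - 1) + 1) ∘ₗ Lam c (m - i.val - 1))) := by
  constructor
  · apply LinearMap.ext
    intro p
    have := hT 1 (fun _ => p)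
    simpa [Lam] using this
  · intro m hm
    obtain ⟨m, rfl⟩ : ∃ k, m = k + 1 := ⟨m - 1, by omega⟩
    apply LinearMap.ext
    intro p
    have hne : ((m + 1 : ℕ) : ℂ) ≠ 0 := by exact_mod_cast Nat.succ_ne_zero m
    have h := congrArg (T (m + 1 + 1)) (Lam_rec c m p)
    rw [map_smul, map_sum] at h
    rw [LinearMap.smul_apply, eq_inv_smul_iff₀ hne, LinearMap.comp_apply, LinearMap.sum_apply]
    push_cast
    rw [h, ← Fin.sum_univ_eq_sum_range
      (fun i => T (m + 1 + 1) (Ex c i (m - i) (m + 1) (Qtens c p)))]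
    refine Finset.sum_congr rfl fun i _ => ?_
    have hi := i.isLt
    have hJ := DFunLike.congr_fun (T_Jx τ T hT (i.val + 1) (m - i.val) (m + 1) (by omega))
      (TensorProduct.map (Lam c i.val) (Lam c (m - i.val)) (Qtens c p))
    rw [show m + 1 - i.val - 1 = m - i.val by omega]
    simp only [pairFunQ, TensorProduct.map_comp, LinearMap.comp_apply] at hJ ⊢
    exact hJ

end
end

section
/- (Trees whose vertices all have valence at least two have no nontrivial symmetries.) Let V be a finite type and G : SimpleGraph V a tree (G.IsTree). Every graph automorphism f : G ≃g G that fixes each vertex of degree at most 1 (i.e., f v = v whenever G.degree v ≤ 1) is the identity. -/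
/-- In a tree, the neighbour of `w` that is closer to `r` is unique. -/
lemma tree_parent_unique {V : Type} (G : SimpleGraph V) (hG : G.IsTree) (r w v v' : V)
    (h : G.Adj v w) (h' : G.Adj v' w) (hd : G.dist r w = G.dist r v + 1)
    (hd' : G.dist r w = G.dist r v' + 1) : v = v' := by
  obtain ⟨q, hq, hql⟩ := hG.connected.exists_path_of_dist r w
  have key : ∀ x, G.Adj x w → G.dist r w = G.dist r x + 1 → x = q.penultimate := by
    intro x hx hdx
    obtain ⟨p, hp, hpl⟩ := hG.connected.exists_path_of_dist r x
    refine hG.isAcyclic.eq_penultimate_of_adj_end hq hx.symm ?_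
    by_contra hxq
    have hw : w ∈ p.support :=
      hG.isAcyclic.mem_support_of_ne_mem_support_of_adj_of_isPath hp hq hx hxq
    have := hG.isAcyclic.path_concat hq hp hx.symm hw
    have hl := congrArg SimpleGraph.Walk.length this
    rw [SimpleGraph.Walk.length_concat] at hl
    omega
  rw [key v h hd, key v' h' hd']

/-- Automorphisms of a connected graph preserve the distance. -/
lemma iso_dist_eq {V : Type} (G : SimpleGraph V) (hG : G.Connected) (f : G ≃g G) (u v : V) :
    G.dist (f u) (f v) = G.dist u v := by
  have key : ∀ (g : G ≃g G) (a b : V), G.dist (g a) (g b) ≤ G.dist a b := by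
    intro g a b
    obtain ⟨p, hp⟩ := hG.exists_walk_length_eq_dist a b
    have h := SimpleGraph.dist_le (p.map g.toHom)
    rw [SimpleGraph.Walk.length_map, hp] at h
    exact h
  refine le_antisymm (key f u v) ?_
  simpa using key f.symm (f u) (f v)

/-- trees whose vertices all have valence at least two have no
nontrivial symmetries: for a finite tree `G` on a vertex type `V`, every graph
automorphism `f : G ≃g G` that fixes each vertex of degree at most `1` is the
identity. -/
theorem tree_automorphism_fixing_leaves_eq_id {V : Type} [Fintype V] [DecidableEq V]
    (G : SimpleGraph V) [DecidableRel G.Adj] (hG : G.IsTree) (f : G ≃g G)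
    (hf : ∀ v, G.degree v ≤ 1 → f v = v) :
    ∀ v, f v = v := by
  rcases subsingleton_or_nontrivial V with hV | hV
  · exact fun v => Subsingleton.elim _ _
  obtain ⟨r, hr⟩ := hG.exists_vert_degree_one_of_nontrivial
  have hfr : f r = r := hf r hr.le
  by_contra! hne
  obtain ⟨v₀, hv₀⟩ := hne
  obtain ⟨v, hv, hmax⟩ := Finset.exists_max_image (Finset.univ.filter fun v => f v ≠ v)
    (fun v => G.dist r v) ⟨v₀, by simpa using hv₀⟩
  simp only [Finset.mem_filter, Finset.mem_univ, true_and] at hv hmax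
  have hdeg : 1 < G.degree v := by
    by_contra h
    exact hv (hf v (not_lt.mp h))
  obtain ⟨a, ha, b, hb, hab⟩ := Finset.one_lt_card.mp hdeg
  rw [SimpleGraph.mem_neighborFinset] at ha hb
  have hchild : ∃ w, G.Adj v w ∧ G.dist r w = G.dist r v + 1 := by
    rcases hG.dist_eq_dist_add_one_of_adj r ha with h1 | h1
    · rcases hG.dist_eq_dist_add_one_of_adj r hb with h2 | h2
      · exact absurd (tree_parent_unique G hG r v a b ha.symm hb.symm h1 h2) hab
      · exact ⟨b, hb, h2⟩
    · exact ⟨a, ha, h1⟩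
  obtain ⟨w, hvw, hw⟩ := hchild
  have hfw : f w = w := by
    by_contra h
    have := hmax w h
    omega
  have hadj : G.Adj (f v) w := by
    have := f.map_adj_iff.mpr hvw
    rwa [hfw] at this
  have hd : G.dist r (f v) = G.dist r v := by
    have := iso_dist_eq G hG.connected f r v
    rwa [hfr] at this
  exact hv (tree_parent_unique G hG r w (f v) v hadj hvw (by rw [hd, hw]) hw)
end
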